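/- Let s be a positive integer. Then 2s^2 + 2s + 1 is the greatest positive integer n such that the cyclic group \mathbb{Z}_n contains an s-spanning set of size 2; that is, \mathbb{Z}_{2s^2+2s+1} contains an s-spanning set of size 2, and if \mathbb{Z}_n contains an s-spanning set of size 2 then n \le 2s^2 + 2s + 1. -/

import Mathlib

/-- `A = {a₁, a₂}` with `a₁ ≠ a₂` is an `s`-spanning set of size 2 of the abelian group `G`:
every `g ∈ G` is `λ₁ • a₁ + λ₂ • a₂` with `|λ₁| + |λ₂| ≤ s`. -/
def HasSpanningPair (G : Type*) [AddCommGroup G] (s : ℕ) : Prop :=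
  ∃ a₁ a₂ : G, a₁ ≠ a₂ ∧ ∀ g : G, ∃ l1 l2 : ℤ,
    |l1| + |l2| ≤ (s : ℤ) ∧ g = l1 • a₁ + l2 • a₂

/-- Every integer `g` with `|g| ≤ s² + s` is a combination `l₁ s + l₂ (s + 1)` with
`|l₁| + |l₂| ≤ s`. -/
lemma exists_combination_of_abs_le {s g : ℤ} (hs : 0 ≤ s) (hg : |g| ≤ s ^ 2 + s) :
    ∃ l1 l2 : ℤ, |l1| + |l2| ≤ s ∧ g = l1 * s + l2 * (s + 1) := by
  obtain ⟨hg₁, hg₂⟩ := abs_le.mp hg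
  have hdiv := Int.mul_ediv_add_emod (2 * g + s) (2 * s + 1)
  have hr₀ := Int.emod_nonneg (2 * g + s) (show 2 * s + 1 ≠ 0 by omega)
  have hr₁ := Int.emod_lt_of_pos (2 * g + s) (show 0 < 2 * s + 1 by omega)
  generalize (2 * g + s) / (2 * s + 1) = k at *
  generalize (2 * g + s) % (2 * s + 1) = r at *
  have hk₁ : k < s + 1 := by nlinarith
  have hk₂ : -s - 1 < k := by nlinarith
  refine ⟨k - (g - k * s), g - k * s, ?_, by ring⟩
  have hl : 2 * (g - k * s) = k + r - s := by linear_combination -hdiv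
  rcases abs_cases (k - (g - k * s)) with h | h <;>
    rcases abs_cases (g - k * s) with h' | h' <;> linarith

/-- A pair `(l₁, l₂)` with `|l₁| + |l₂| ≤ s` is determined by `l₁ s + l₂ (s + 1)`, since
`l₁ + l₂` is a quotient by `2 s + 1`. -/
lemma combination_ediv {s l1 l2 : ℤ} (hl : |l1| + |l2| ≤ s) :
    (2 * (l1 * s + l2 * (s + 1)) + s) / (2 * s + 1) = l1 + l2 := by
  have h₁ := abs_le.mp ((abs_sub l2 l1).trans (by linarith : |l2| + |l1| ≤ s))
  have h₀ : 0 ≤ s := by linarith [abs_nonneg l1, abs_nonneg l2]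
  rw [Int.ediv_eq_iff_of_pos (by linarith)]
  constructor <;> nlinarith

/-- A combination `l₁ s + l₂ (s + 1)` with `|l₁| + |l₂| ≤ s` has absolute value at most
`s² + s`. -/
lemma abs_combination_le {s l1 l2 : ℤ} (hl : |l1| + |l2| ≤ s) :
    |l1 * s + l2 * (s + 1)| ≤ s ^ 2 + s := by
  have h₁ := abs_nonneg l1
  have h₂ := abs_nonneg l2
  calc |l1 * s + l2 * (s + 1)| ≤ |l1 * s| + |l2 * (s + 1)| := abs_add_le _ _
    _ = |l1| * s + |l2| * (s + 1) := by
      rw [abs_mul, abs_mul, abs_of_nonneg (show 0 ≤ s by linarith),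
        abs_of_nonneg (show 0 ≤ s + 1 by linarith)]
    _ ≤ s ^ 2 + s := by nlinarith

/-- The integers `s` and `s + 1` give an `s`-spanning pair modulo `2 s² + 2 s + 1`. -/
lemma hasSpanningPair_zmod (s : ℕ) (hs : 0 < s) :
    HasSpanningPair (ZMod (2 * s ^ 2 + 2 * s + 1)) s := by
  have : Fact (1 < 2 * s ^ 2 + 2 * s + 1) := ⟨by omega⟩
  refine ⟨(s : ZMod _), (s : ZMod _) + 1, by simp, fun g ↦ ?_⟩
  have hg := ZMod.natAbs_valMinAbs_le g
  have hg' : |g.valMinAbs| ≤ (s : ℤ) ^ 2 + s := by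
    rw [Int.abs_eq_natAbs]
    exact_mod_cast hg.trans (by omega)
  obtain ⟨l1, l2, hl, h⟩ := exists_combination_of_abs_le (Int.natCast_nonneg s) hg'
  refine ⟨l1, l2, hl, ?_⟩
  rw [← ZMod.coe_valMinAbs g, h]
  simp [zsmul_eq_mul, mul_add]

/-- A group with an `s`-spanning set of size 2 has at most `2 s² + 2 s + 1` elements. -/
lemma HasSpanningPair.card_le {G : Type*} [AddCommGroup G] {s : ℕ} (h : HasSpanningPair G s) :
    Nat.card G ≤ 2 * s ^ 2 + 2 * s + 1 := by
  obtain ⟨a₁, a₂, -, h⟩ := h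
  let k : ℤ → ℤ := fun m ↦ (2 * m + s) / (2 * s + 1)
  let f : Set.Icc (-((s : ℤ) ^ 2 + s)) ((s : ℤ) ^ 2 + s) → G := fun m ↦
    (k m - (m - k m * s)) • a₁ + (m - k m * s) • a₂
  have hf : Function.Surjective f := by
    intro g
    obtain ⟨l1, l2, hl, rfl⟩ := h g
    refine ⟨⟨l1 * s + l2 * (s + 1), abs_le.mp (abs_combination_le hl)⟩, ?_⟩
    simp only [f, k, combination_ediv hl]
    congr 2 <;> ring
  refine (Nat.card_le_card_of_surjective f hf).trans_eq ?_
  rw [Nat.card_eq_fintype_card, Fintype.card_ofFinset, Int.card_Icc]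
  zify
  rw [Int.toNat_of_nonneg (by rw [sub_neg_eq_add]; positivity)]
  ring

/-- **Theorem 5.** For a positive integer `s`, the largest `n` such that the cyclic group `ℤ_n`
has an `s`-spanning set of size 2 is `2s² + 2s + 1`. -/
theorem max_cyclic_with_spanning_pair (s : ℕ) (hs : 0 < s) :
    HasSpanningPair (ZMod (2 * s ^ 2 + 2 * s + 1)) s ∧
    ∀ n : ℕ, 0 < n → HasSpanningPair (ZMod n) s → n ≤ 2 * s ^ 2 + 2 * s + 1 := by
  refine ⟨hasSpanningPair_zmod s hs, fun n _ h ↦ ?_⟩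
  simpa using h.card_le
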